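/- Let p ≥ 3 be a prime, r > 2p an integer with r ≡ a mod (p−1) where 2 ≤ a ≤ p−1, and suppose p ∤ r and Σ_p(r−1) = a−1. Then dim_{F_p} X_{r−1} = 2a, and there is an M-equivariant F_p-linear isomorphism X_{r−1} ≅ (V_{a−2} ⊗ D) ⊕ V_a. -/

import Mathlib

open MvPolynomial

/-- The action of a 2×2 matrix `g` over `F_p` on polynomials in two variables:
`((a b; c d) · F)(X, Y) = F (aX + cY, bX + dY)`. -/
noncomputable def matAct (p : ℕ) (g : Matrix (Fin 2) (Fin 2) (ZMod p)) :
    MvPolynomial (Fin 2) (ZMod p) →ₐ[ZMod p] MvPolynomial (Fin 2) (ZMod p) :=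
  aeval fun i => ∑ j, C (g j i) * X j

/-- The action of `g` twisted by the `n`-th power of the determinant character `D`. -/
noncomputable def twAct (p n : ℕ) (g : Matrix (Fin 2) (Fin 2) (ZMod p))
    (F : MvPolynomial (Fin 2) (ZMod p)) : MvPolynomial (Fin 2) (ZMod p) :=
  g.det ^ n • matAct p g F

/-- `V_m`: homogeneous polynomials of degree `m` in two variables over `F_p`. -/
noncomputable def Vh (p m : ℕ) : Submodule (ZMod p) (MvPolynomial (Fin 2) (ZMod p)) :=
  homogeneousSubmodule (Fin 2) (ZMod p) m

/-- `X_r`: the `M`-submodule of `V_r` generated by `X^r`, realized as the span of the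
orbit of `X^r` under the monoid `M = M_2(F_p)`. -/
noncomputable def XrSub (p r : ℕ) : Submodule (ZMod p) (MvPolynomial (Fin 2) (ZMod p)) :=
  Submodule.span (ZMod p)
    (Set.range fun g : Matrix (Fin 2) (Fin 2) (ZMod p) => matAct p g (X 0 ^ r))

/-- `X_{r-1}`: the `M`-submodule of `V_r` generated by `X^{r-1} Y`. -/
noncomputable def Xr1Sub (p r : ℕ) : Submodule (ZMod p) (MvPolynomial (Fin 2) (ZMod p)) :=
  Submodule.span (ZMod p)
    (Set.range fun g : Matrix (Fin 2) (Fin 2) (ZMod p) => matAct p g (X 0 ^ (r - 1) * X 1))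

/-- The special polynomial `θ = X^p Y − X Y^p`. -/
noncomputable def theta (p : ℕ) : MvPolynomial (Fin 2) (ZMod p) :=
  X 0 ^ p * X 1 - X 0 * X 1 ^ p

/-- `V_r^* = {F ∈ V_r : θ ∣ F}`. -/
noncomputable def Vstar (p r : ℕ) : Submodule (ZMod p) (MvPolynomial (Fin 2) (ZMod p)) :=
  Vh p r ⊓ (Ideal.span {theta p}).restrictScalars (ZMod p)

/-- `V_r^{**} = {F ∈ V_r : θ² ∣ F}`. -/
noncomputable def Vdstar (p r : ℕ) : Submodule (ZMod p) (MvPolynomial (Fin 2) (ZMod p)) :=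
  Vh p r ⊓ (Ideal.span {theta p ^ 2}).restrictScalars (ZMod p)

/-- `M`-equivariance of a linear map between two submodules of the polynomial ring,
where the source carries the action twisted by `D^{nA}` and the target by `D^{nB}`. -/
def EquivMap (p nA nB : ℕ)
    {A B : Submodule (ZMod p) (MvPolynomial (Fin 2) (ZMod p))}
    (φ : A →ₗ[ZMod p] B) : Prop :=
  ∀ (g : Matrix (Fin 2) (Fin 2) (ZMod p)) (x y : A),
    (y : MvPolynomial (Fin 2) (ZMod p)) = twAct p nA g (x : MvPolynomial (Fin 2) (ZMod p)) →
    (φ y : MvPolynomial (Fin 2) (ZMod p)) = twAct p nB g (φ x : MvPolynomial (Fin 2) (ZMod p))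

namespace Xr1Iso

variable {p : ℕ}

/-- The linear form `αX + βY`. -/
noncomputable def lin (p : ℕ) (α β : ZMod p) : MvPolynomial (Fin 2) (ZMod p) :=
  C α * X 0 + C β * X 1

/-- The sum of the base `p` digits. -/
def digitSum (p k : ℕ) : ℕ := (Nat.digits p k).sum

theorem digitSum_add_mul (hp : 1 < p) {x : ℕ} (hx : x < p) (y : ℕ) :
    digitSum p (x + p * y) = x + digitSum p y := by
  by_cases h : x ≠ 0 ∨ y ≠ 0
  · simp [digitSum, Nat.digits_add p hp x y hx h]
  · push Not at h
    simp [digitSum, h.1, h.2]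

theorem matAct_matAct (g h : Matrix (Fin 2) (Fin 2) (ZMod p))
    (F : MvPolynomial (Fin 2) (ZMod p)) :
    matAct p h (matAct p g F) = matAct p (h * g) F := by
  suffices h' : (matAct p h).comp (matAct p g) = matAct p (h * g) from DFunLike.congr_fun h' F
  refine algHom_ext fun i => ?_
  simp only [matAct, AlgHom.comp_apply, aeval_X, Fin.sum_univ_two, map_add, map_mul, algHom_C,
    algebraMap_eq, Matrix.mul_apply]
  ring

theorem matAct_X (g : Matrix (Fin 2) (Fin 2) (ZMod p)) (i : Fin 2) :
    matAct p g (X i) = lin p (g 0 i) (g 1 i) := by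
  simp [matAct, lin]

theorem lin_isHomogeneous (α β : ZMod p) : (lin p α β).IsHomogeneous 1 :=
  (isHomogeneous_C_mul_X α 0).add (isHomogeneous_C_mul_X β 1)

/-- The linear map sending `X^u Y^t` to `X^{Σ_p(u)} Y^{Σ_p(t)}`. -/
noncomputable def digitMap (p : ℕ) :
    MvPolynomial (Fin 2) (ZMod p) →ₗ[ZMod p] MvPolynomial (Fin 2) (ZMod p) :=
  (basisMonomials (Fin 2) (ZMod p)).constr (ZMod p) fun d =>
    monomial (d.mapRange (digitSum p) (by simp [digitSum])) 1

theorem digitMap_monomial (d : Fin 2 →₀ ℕ) (c : ZMod p) :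
    digitMap p (monomial d c) =
      monomial (d.mapRange (digitSum p) (by simp [digitSum])) c := by
  have h : digitMap p (monomial d 1) =
      monomial (d.mapRange (digitSum p) (by simp [digitSum])) 1 := by
    have := (basisMonomials (Fin 2) (ZMod p)).constr_basis (ZMod p) (fun d =>
      (monomial (d.mapRange (digitSum p) (by simp [digitSum])) 1 :
        MvPolynomial (Fin 2) (ZMod p))) d
    rwa [coe_basisMonomials] at this
  have hc : (monomial d c : MvPolynomial (Fin 2) (ZMod p)) = c • monomial d 1 := by
    simp [smul_monomial]
  rw [hc, map_smul, h, smul_monomial]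
  simp


theorem pow_mul_isHomogeneous (α β γ δ : ZMod p) (m : ℕ) :
    (lin p α β ^ m * lin p γ δ).IsHomogeneous (m + 1) := by
  simpa using ((lin_isHomogeneous α β).pow m).mul (lin_isHomogeneous γ δ)

theorem lin_pow_eq (α β : ZMod p) (s : ℕ) :
    lin p α β ^ s = lin p α β ^ (s % p) * (lin p α β ^ (s / p)) ^ p := by
  rw [← pow_mul, ← pow_add, mul_comm (s / p), Nat.mod_add_div]

/-- The operator `∂_X ∘ π ∘ ∂_Y - ∂_Y ∘ π ∘ ∂_X`, where `π` is `digitMap`. -/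
noncomputable def digitBracket (p : ℕ) :
    MvPolynomial (Fin 2) (ZMod p) →ₗ[ZMod p] MvPolynomial (Fin 2) (ZMod p) :=
  (pderiv 0).toLinearMap ∘ₗ digitMap p ∘ₗ (pderiv 1).toLinearMap -
    (pderiv 1).toLinearMap ∘ₗ digitMap p ∘ₗ (pderiv 0).toLinearMap

theorem pderiv_comm (F : MvPolynomial (Fin 2) (ZMod p)) :
    pderiv 0 (pderiv 1 F) = pderiv 1 (pderiv 0 F) := by
  induction F using MvPolynomial.induction_on with
  | C a => simp
  | add f g hf hg => simp only [map_add, hf, hg]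
  | mul_X f i hf =>
    fin_cases i <;> simp [Derivation.leibniz, pderiv_X, hf, add_comm]

theorem pderiv_zero_lin (α β : ZMod p) : pderiv 0 (lin p α β) = C α := by
  simp [lin, pderiv_X, Derivation.leibniz]

theorem pderiv_one_lin (α β : ZMod p) : pderiv 1 (lin p α β) = C β := by
  simp [lin, pderiv_X, Derivation.leibniz]

theorem pderiv_zero_lin_pow_succ (α β : ZMod p) (n : ℕ) :
    pderiv 0 (lin p α β ^ (n + 1)) = C ((n + 1 : ℕ) * α) * lin p α β ^ n := by
  rw [Derivation.leibniz_pow, pderiv_zero_lin]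
  simp
  ring

theorem pderiv_one_lin_pow_succ (α β : ZMod p) (n : ℕ) :
    pderiv 1 (lin p α β ^ (n + 1)) = C ((n + 1 : ℕ) * β) * lin p α β ^ n := by
  rw [Derivation.leibniz_pow, pderiv_one_lin]
  simp
  ring

theorem weight_one_eq (d : Fin 2 →₀ ℕ) : Finsupp.weight (1 : Fin 2 → ℕ) d = d 0 + d 1 := by
  simp [Finsupp.weight_apply, Finsupp.sum_fintype]

section Prime

variable [hp : Fact p.Prime]

theorem digitMap_mul_pow {F : MvPolynomial (Fin 2) (ZMod p)} {k : ℕ} (hF : F.IsHomogeneous k)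
    (hk : k < p) (G : MvPolynomial (Fin 2) (ZMod p)) :
    digitMap p (F * G ^ p) = F * digitMap p G := by
  rw [← expand_zmod]
  induction G using MvPolynomial.induction_on' with
  | add a b ha hb => simp only [map_add, mul_add, ha, hb]
  | monomial v c =>
    rw [expand_monomial, digitMap_monomial]
    conv_lhs => rw [F.as_sum]
    conv_rhs => rw [F.as_sum]
    rw [Finset.sum_mul, Finset.sum_mul, map_sum]
    refine Finset.sum_congr rfl fun d hd => ?_
    rw [monomial_mul, monomial_mul, digitMap_monomial]
    congr 2
    ext i
    have hdeg := hF (mem_support_iff.mp hd)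
    have hi : d i < p := by
      refine lt_of_le_of_lt ?_ hk
      rw [← hdeg, Finsupp.weight_apply, Finsupp.sum_fintype _ _ (by simp)]
      simpa using Finset.single_le_sum (f := fun i => d i) (fun _ _ => Nat.zero_le _)
        (Finset.mem_univ i)
    simpa using digitSum_add_mul hp.out.one_lt hi (v i)

theorem pderiv_pow_char (i : Fin 2) (G : MvPolynomial (Fin 2) (ZMod p)) :
    pderiv i (G ^ p) = 0 := by
  simp [Derivation.leibniz_pow]

theorem digitSum_eq (s : ℕ) : digitSum p s = s % p + digitSum p (s / p) := by
  conv_lhs => rw [← Nat.mod_add_div s p]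
  exact digitSum_add_mul hp.out.one_lt (Nat.mod_lt _ hp.out.pos) _

theorem digitSum_pos {k : ℕ} (hk : 0 < k) : 0 < digitSum p k := by
  induction k using Nat.strong_induction_on with
  | _ k ih =>
    rw [digitSum_eq]
    rcases lt_or_ge k p with h | h
    · rw [Nat.mod_eq_of_lt h]
      omega
    · have := ih _ (Nat.div_lt_self hk hp.out.one_lt) (Nat.div_pos h hp.out.pos)
      omega

theorem digitMap_lin_pow (α β : ZMod p) (s : ℕ) :
    digitMap p (lin p α β ^ s) = lin p α β ^ digitSum p s := by
  induction s using Nat.strong_induction_on with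
  | _ s ih =>
    rcases Nat.eq_zero_or_pos s with rfl | hs
    · have := digitMap_monomial (p := p) 0 1
      simpa [digitSum] using this
    · have hF : (lin p α β ^ (s % p)).IsHomogeneous (s % p) := by
        simpa using (lin_isHomogeneous α β).pow (s % p)
      rw [lin_pow_eq, digitMap_mul_pow hF (Nat.mod_lt _ hp.out.pos),
        ih _ (Nat.div_lt_self hs hp.out.one_lt), ← pow_add, ← digitSum_eq]

theorem digitMap_generator (α β γ δ : ZMod p) {s : ℕ} (hs : s % p + 1 < p) :
    digitMap p (lin p α β ^ s * lin p γ δ) = lin p α β ^ digitSum p s * lin p γ δ := by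
  rw [lin_pow_eq, mul_right_comm, digitMap_mul_pow (pow_mul_isHomogeneous α β γ δ _) hs,
    digitMap_lin_pow, mul_right_comm, ← pow_add, ← digitSum_eq]

theorem digitMap_pderiv_generator (i : Fin 2) (α β γ δ : ZMod p) {s : ℕ} (hs : s % p + 1 < p) :
    digitMap p (pderiv i (lin p α β ^ s * lin p γ δ)) =
      pderiv i (lin p α β ^ (s % p) * lin p γ δ) * lin p α β ^ digitSum p (s / p) := by
  rw [lin_pow_eq, mul_right_comm, Derivation.leibniz, pderiv_pow_char, smul_zero, zero_add,
    smul_eq_mul, mul_comm, digitMap_mul_pow (pow_mul_isHomogeneous α β γ δ _).pderiv (by omega),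
    digitMap_lin_pow]

theorem digitBracket_generator (α β γ δ : ZMod p) {s : ℕ} (hs : s % p + 1 < p) {n : ℕ}
    (hn : digitSum p (s / p) = n + 1) :
    digitBracket p (lin p α β ^ s * lin p γ δ) =
      (((n + 1 : ℕ) : ZMod p) * (α * δ - β * γ)) • lin p α β ^ (digitSum p s - 1) := by
  have hcomm := pderiv_comm (lin p α β ^ (s % p) * lin p γ δ)
  have hd : digitSum p s - 1 = s % p + n := by rw [digitSum_eq, hn]; omega
  simp only [digitBracket, LinearMap.sub_apply, LinearMap.comp_apply, Derivation.coeFn_coe,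
    digitMap_pderiv_generator _ α β γ δ hs, hn]
  rw [Derivation.leibniz (pderiv 0) (pderiv 1 _), Derivation.leibniz (pderiv 1) (pderiv 0 _),
    hcomm, pderiv_zero_lin_pow_succ, pderiv_one_lin_pow_succ, hd, Derivation.leibniz (pderiv 0),
    Derivation.leibniz (pderiv 1) (lin p α β ^ (s % p))]
  simp only [pderiv_zero_lin, pderiv_one_lin, smul_eq_mul, smul_eq_C_mul, C_mul, C_sub]
  cases s % p with
  | zero => simp; ring
  | succ m =>
    rw [pderiv_zero_lin_pow_succ, pderiv_one_lin_pow_succ]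
    simp
    ring

theorem Vh_le_span_lin_pow {m : ℕ} (hm : m < p) :
    Vh p m ≤ Submodule.span (ZMod p) (Set.range fun β : ZMod p => lin p 1 β ^ m) := by
  rintro F hF
  rw [← Subspace.forall_mem_dualAnnihilator_apply_eq_zero_iff]
  intro φ hφ
  rw [Submodule.mem_dualAnnihilator] at hφ
  let c : ℕ → ZMod p := fun k => φ (X 0 ^ (m - k) * X 1 ^ k) * m.choose k
  have hc : (∑ k ∈ Finset.range (m + 1), Polynomial.C (c k) * Polynomial.X ^ k) = 0 := by
    refine Polynomial.eq_zero_of_natDegree_lt_card_of_eval_eq_zero _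
      (Function.injective_id (α := ZMod p)) (fun β => ?_) ?_
    · rw [id, ← hφ _ (Submodule.subset_span ⟨β, rfl⟩)]
      simp only [lin, C_1, one_mul]
      rw [add_comm (X 0), add_pow, map_sum, Polynomial.eval_finsetSum]
      refine Finset.sum_congr rfl fun k _ => ?_
      have : (C β * X 1) ^ k * X 0 ^ (m - k) * ((m.choose k : ℕ) : MvPolynomial (Fin 2) (ZMod p)) =
          (β ^ k * (m.choose k : ℕ)) • (X 0 ^ (m - k) * X 1 ^ k) := by
        rw [smul_eq_C_mul, mul_pow, C_mul, C_pow, map_natCast]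
        ring
      rw [this, map_smul]
      simp [c]
      ring
    · rw [ZMod.card]
      refine lt_of_le_of_lt (Polynomial.natDegree_sum_le_of_forall_le (n := m) _ _ fun k hk => ?_) hm
      exact (Polynomial.natDegree_C_mul_X_pow_le _ _).trans
        (Nat.lt_succ_iff.mp (Finset.mem_range.mp hk))
  have hmono : ∀ k ≤ m, φ (X 0 ^ (m - k) * X 1 ^ k) = 0 := by
    intro k hk
    have h := congrArg (fun q => Polynomial.coeff q k) hc
    have hch : ((m.choose k : ℕ) : ZMod p) ≠ 0 := by
      rw [Ne, ZMod.natCast_eq_zero_iff]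
      exact fun hd => absurd (hp.out.dvd_factorial.mp
        (hd.trans (Nat.choose_mul_factorial_mul_factorial hk ▸ (Dvd.intro _ (mul_assoc _ _ _).symm))))
        (by omega)
    simp only [Polynomial.finsetSum_coeff, Polynomial.coeff_C_mul, Polynomial.coeff_X_pow] at h
    simpa [c, Nat.lt_succ_iff, hk, hch] using h
  rw [F.as_sum, map_sum]
  refine Finset.sum_eq_zero fun d hd => ?_
  have hdeg : d 0 + d 1 = m := by
    have := hF (mem_support_iff.mp hd)
    simpa [Finsupp.weight_apply, Finsupp.sum_fintype] using this
  rw [monomial_eq, Finsupp.prod_fintype _ _ (by simp), Fin.prod_univ_two, ← smul_eq_C_mul, map_smul]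
  rw [show d 0 = m - d 1 by omega, hmono _ (by omega), smul_zero]

/-- Exponents of total degree `m` in two variables. -/
noncomputable def exponentEquiv (m : ℕ) : {d : Fin 2 →₀ ℕ | d.degree = m} ≃ Fin (m + 1) where
  toFun d := ⟨d.1 0, by
    have := d.2
    simp [Finsupp.degree_eq_sum] at this
    omega⟩
  invFun k := ⟨Finsupp.equivFunOnFinite.symm ![k, m - k], by
    have := k.2
    simp [Finsupp.degree_eq_sum]
    omega⟩
  left_inv d := by
    have := d.2
    simp [Finsupp.degree_eq_sum] at this
    ext i
    fin_cases i
    · simp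
    · simp
      omega
  right_inv k := by simp

/-- Coordinates on `V_m` in its monomial basis. -/
noncomputable def VhEquiv (m : ℕ) : Vh p m ≃ₗ[ZMod p] (Fin (m + 1) →₀ ZMod p) :=
  (LinearEquiv.ofEq _ _ (homogeneousSubmodule_eq_finsupp_supported (Fin 2) (ZMod p) m)).trans
    ((AddMonoidAlgebra.supportedEquivFinsupp _).trans
      (Finsupp.domLCongr (exponentEquiv m)))

theorem finrank_Vh (m : ℕ) : Module.finrank (ZMod p) (Vh p m) = m + 1 := by
  rw [(VhEquiv m).finrank_eq, Module.finrank_finsupp_self, Fintype.card_fin]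

instance (m : ℕ) : Module.Finite (ZMod p) (Vh p m) := Module.Finite.equiv (VhEquiv m).symm

theorem exists_isHomogeneous_eval_eq_lin_pow (s : ℕ) :
    ∃ P : MvPolynomial (Fin 2) (MvPolynomial (Fin 2) (ZMod p)), P.IsHomogeneous (digitSum p s) ∧
      ∀ α β, eval ![C α, C β] P = lin p α β ^ s := by
  induction s using Nat.strong_induction_on with
  | _ s ih =>
    rcases Nat.eq_zero_or_pos s with rfl | hs
    · exact ⟨1, by simpa [digitSum] using isHomogeneous_one _ _, by simp⟩
    · obtain ⟨P, hP, hPe⟩ := ih _ (Nat.div_lt_self hs hp.out.one_lt)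
      refine ⟨(C (X 0) * X 0 + C (X 1) * X 1) ^ (s % p) * map (frobenius _ p) P, ?_, fun α β => ?_⟩
      · rw [digitSum_eq]
        have h : (C (X 0) * X 0 + C (X 1) * X 1 :
            MvPolynomial (Fin 2) (MvPolynomial (Fin 2) (ZMod p))).IsHomogeneous 1 :=
          (isHomogeneous_C_mul_X _ 0).add (isHomogeneous_C_mul_X _ 1)
        simpa using (h.pow (s % p)).mul (hP.map _)
      · have hfix : (![C α, C β] : Fin 2 → MvPolynomial (Fin 2) (ZMod p)) =
            fun i => frobenius _ p (![C α, C β] i) := by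
          funext i
          fin_cases i <;> simp [frobenius_def, ← C_pow]
        rw [map_mul, lin_pow_eq]
        congr 1
        · simp [lin, mul_comm]
        · conv_lhs => rw [hfix]
          rw [eval_map, ← hPe, ← frobenius_def]
          exact (eval₂_comp_left (frobenius _ p) (RingHom.id _) _ P).symm

theorem finrank_Xr1Sub_le (r : ℕ) :
    Module.Finite (ZMod p) (Xr1Sub p r) ∧
      Module.finrank (ZMod p) (Xr1Sub p r) ≤ 2 * (digitSum p (r - 1) + 1) := by
  classical
  obtain ⟨P, hP, hPe⟩ := exists_isHomogeneous_eval_eq_lin_pow (p := p) (r - 1)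
  let T : Finset (MvPolynomial (Fin 2) (ZMod p)) :=
    (P.support ×ˢ (Finset.univ : Finset (Fin 2))).image fun x => coeff x.1 P * X x.2
  have hT : T.card ≤ 2 * (digitSum p (r - 1) + 1) := by
    refine Finset.card_image_le.trans ?_
    rw [Finset.card_product, Finset.card_univ, Fintype.card_fin, mul_comm]
    refine Nat.mul_le_mul_left _ ?_
    rw [← Finset.card_range (digitSum p (r - 1) + 1)]
    refine Finset.card_le_card_of_injOn (fun d => d 0) (fun d hd => ?_) fun d hd e he hde => ?_
    · have := hP (mem_support_iff.mp hd)
      rw [weight_one_eq] at this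
      simp
      omega
    · have h1 := hP (mem_support_iff.mp hd)
      have h2 := hP (mem_support_iff.mp he)
      rw [weight_one_eq] at h1 h2
      ext i
      fin_cases i
      · exact hde
      · simp at hde ⊢
        omega
  have hle : Xr1Sub p r ≤ Submodule.span (ZMod p) (T : Set (MvPolynomial (Fin 2) (ZMod p))) := by
    refine Submodule.span_le.mpr ?_
    rintro _ ⟨g, rfl⟩
    simp only [map_mul, map_pow, matAct_X]
    rw [← hPe, eval_eq', Finset.sum_mul]
    refine Submodule.sum_mem _ fun d hd => ?_
    have hmem : ∀ i, coeff d P * X i ∈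
        Submodule.span (ZMod p) (T : Set (MvPolynomial (Fin 2) (ZMod p))) := fun i =>
      Submodule.subset_span (Finset.mem_coe.mpr (Finset.mem_image.mpr
        ⟨(d, i), Finset.mem_product.mpr ⟨hd, Finset.mem_univ _⟩, rfl⟩))
    have : coeff d P * (∏ i, ![C (g 0 0), C (g 1 0)] i ^ d i) * lin p (g 0 1) (g 1 1) =
        (g 0 0 ^ d 0 * g 1 0 ^ d 1) • (g 0 1 • (coeff d P * X 0) + g 1 1 • (coeff d P * X 1)) := by
      simp [Fin.prod_univ_two, smul_eq_C_mul, lin]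
      ring
    rw [this]
    exact Submodule.smul_mem _ _ (Submodule.add_mem _ (Submodule.smul_mem _ _ (hmem 0))
      (Submodule.smul_mem _ _ (hmem 1)))
  have hfin : Module.Finite (ZMod p)
      (Submodule.span (ZMod p) (T : Set (MvPolynomial (Fin 2) (ZMod p)))) :=
    FiniteDimensional.span_finset _ _
  exact ⟨Submodule.finiteDimensional_of_le hle,
    (Submodule.finrank_mono hle).trans ((finrank_span_finset_le_card _).trans hT)⟩

end Prime

end Xr1Iso

open Xr1Iso

/-- For a prime `p ≥ 3`, `r > 2p` with `r ≡ a mod (p−1)`, `2 ≤ a ≤ p−1`,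
`p ∤ r` and `Σ_p(r−1) = a − 1`, one has `dim X_{r−1} = 2a` and an `M`-equivariant
isomorphism `X_{r−1} ≅ (V_{a−2} ⊗ D) ⊕ V_a`. -/
theorem Xr1_iso_sum (p r a : ℕ) (hp : p.Prime) (hp3 : 3 ≤ p) (hr : 2 * p < r)
    (ha : 2 ≤ a) (ha2 : a ≤ p - 1) (hmod : r ≡ a [MOD p - 1])
    (hpr : ¬ p ∣ r) (hsig : (Nat.digits p (r - 1)).sum = a - 1) :
    Module.finrank (ZMod p) ↥(Xr1Sub p r) = 2 * a ∧
    ∃ e : ↥(Xr1Sub p r) ≃ₗ[ZMod p] (↥(Vh p (a - 2)) × ↥(Vh p a)),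
      EquivMap p 0 1
        ((LinearMap.fst (ZMod p) ↥(Vh p (a - 2)) ↥(Vh p a)).comp e.toLinearMap) ∧
      EquivMap p 0 0
        ((LinearMap.snd (ZMod p) ↥(Vh p (a - 2)) ↥(Vh p a)).comp e.toLinearMap) := by
  have : Fact p.Prime := ⟨hp⟩
  obtain ⟨s, rfl⟩ : ∃ s, r = s + 1 := ⟨r - 1, by omega⟩
  obtain ⟨b, rfl⟩ : ∃ b, a = b + 2 := ⟨a - 2, by omega⟩
  change digitSum p s = b + 1 at hsig
  have hpos : 0 < digitSum p (s / p) :=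
    digitSum_pos (Nat.div_pos (by omega) (by omega))
  have hsplit := digitSum_eq (p := p) s
  have hs : s % p + 1 < p := by omega
  obtain ⟨n, hn⟩ : ∃ n, digitSum p (s / p) = n + 1 := ⟨_, (Nat.sub_add_cancel hpos).symm⟩
  have hn0 : ((n + 1 : ℕ) : ZMod p) ≠ 0 := by
    rw [Ne, ZMod.natCast_eq_zero_iff]
    exact fun h => absurd (Nat.le_of_dvd (by omega) h) (by omega)
  have hmap : ∀ g, digitMap p (matAct p g (X 0 ^ s * X 1)) =
      matAct p g (X 0 ^ (b + 1) * X 1) := fun g => by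
    simp only [map_mul, map_pow, matAct_X]
    rw [digitMap_generator _ _ _ _ hs, hsig]
  have hbr : ∀ g, digitBracket p (matAct p g (X 0 ^ s * X 1)) =
      (((n + 1 : ℕ) : ZMod p) * g.det) • matAct p g (X 0 ^ b) := fun g => by
    simp only [map_mul, map_pow, matAct_X]
    rw [digitBracket_generator _ _ _ _ hs hn, hsig, Matrix.det_fin_two, mul_comm (g 1 0)]
    rfl
  have hbrV : ∀ x ∈ Xr1Sub p (s + 1), digitBracket p x ∈ Vh p b := by
    change Xr1Sub p (s + 1) ≤ (Vh p b).comap (digitBracket p)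
    refine Submodule.span_le.mpr ?_
    rintro _ ⟨g, rfl⟩
    change digitBracket p (matAct p g (X 0 ^ s * X 1)) ∈ Vh p b
    rw [hbr]
    refine Submodule.smul_mem _ _ ?_
    rw [map_pow, matAct_X]
    have h := (lin_isHomogeneous (g 0 0) (g 1 0)).pow b
    rwa [one_mul] at h
  have hmapV : ∀ x ∈ Xr1Sub p (s + 1), digitMap p x ∈ Vh p (b + 2) := by
    change Xr1Sub p (s + 1) ≤ (Vh p (b + 2)).comap (digitMap p)
    refine Submodule.span_le.mpr ?_
    rintro _ ⟨g, rfl⟩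
    change digitMap p (matAct p g (X 0 ^ s * X 1)) ∈ Vh p (b + 2)
    rw [hmap, map_mul, map_pow, matAct_X, matAct_X]
    exact pow_mul_isHomogeneous _ _ _ _ (b + 1)
  have hmapE : ∀ h, ∀ x ∈ Xr1Sub p (s + 1),
      digitMap p (matAct p h x) = matAct p h (digitMap p x) := fun h => by
    change Xr1Sub p (s + 1) ≤ LinearMap.eqLocus (digitMap p ∘ₗ (matAct p h).toLinearMap)
      ((matAct p h).toLinearMap ∘ₗ digitMap p)
    refine Submodule.span_le.mpr ?_
    rintro _ ⟨g, rfl⟩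
    change digitMap p (matAct p h (matAct p g (X 0 ^ s * X 1))) =
      matAct p h (digitMap p (matAct p g (X 0 ^ s * X 1)))
    rw [matAct_matAct, hmap, hmap, matAct_matAct]
  have hbrE : ∀ h, ∀ x ∈ Xr1Sub p (s + 1),
      digitBracket p (matAct p h x) = h.det • matAct p h (digitBracket p x) := fun h => by
    change Xr1Sub p (s + 1) ≤ LinearMap.eqLocus (digitBracket p ∘ₗ (matAct p h).toLinearMap)
      (h.det • (matAct p h).toLinearMap ∘ₗ digitBracket p)
    refine Submodule.span_le.mpr ?_
    rintro _ ⟨g, rfl⟩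
    change digitBracket p (matAct p h (matAct p g (X 0 ^ s * X 1))) =
      h.det • matAct p h (digitBracket p (matAct p g (X 0 ^ s * X 1)))
    rw [matAct_matAct, hbr, hbr, map_smul, matAct_matAct, smul_smul, Matrix.det_mul]
    congr 1
    ring
  have hsurj_map : ∀ F ∈ Vh p (b + 2), ∃ x ∈ Xr1Sub p (s + 1),
      digitBracket p x = 0 ∧ digitMap p x = F := by
    suffices h : Vh p (b + 2) ≤
        (Xr1Sub p (s + 1) ⊓ LinearMap.ker (digitBracket p)).map (digitMap p) by
      intro F hF
      obtain ⟨x, ⟨hx, hx0⟩, hxF⟩ := h hF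
      exact ⟨x, hx, hx0, hxF⟩
    refine (Vh_le_span_lin_pow (by omega)).trans (Submodule.span_le.mpr ?_)
    rintro _ ⟨β, rfl⟩
    refine ⟨matAct p !![1, 1; β, β] (X 0 ^ s * X 1),
      ⟨Submodule.subset_span ⟨_, rfl⟩, ?_⟩, ?_⟩
    · change digitBracket p _ = 0
      rw [hbr]
      simp [Matrix.det_fin_two]
    · rw [hmap, map_mul, map_pow, matAct_X, matAct_X]
      simp [pow_succ]
  have hsurj_br : ∀ F ∈ Vh p b, ∃ x ∈ Xr1Sub p (s + 1), digitBracket p x = F := by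
    change Vh p b ≤ (Xr1Sub p (s + 1)).map (digitBracket p)
    refine (Vh_le_span_lin_pow (by omega)).trans (Submodule.span_le.mpr ?_)
    rintro _ ⟨β, rfl⟩
    refine ⟨((n + 1 : ℕ) : ZMod p)⁻¹ • matAct p !![1, 0; β, 1] (X 0 ^ s * X 1),
      Submodule.smul_mem _ _ (Submodule.subset_span ⟨_, rfl⟩), ?_⟩
    rw [map_smul, hbr, smul_smul, ← mul_assoc, inv_mul_cancel₀ hn0, map_pow, matAct_X]
    simp [Matrix.det_fin_two]
  let φ : Xr1Sub p (s + 1) →ₗ[ZMod p] Vh p b × Vh p (b + 2) :=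
    ((digitBracket p).restrict hbrV).prod ((digitMap p).restrict hmapV)
  have hφ : Function.Surjective φ := by
    rintro ⟨F, G⟩
    obtain ⟨x, hx, hxF⟩ := hsurj_br F F.2
    obtain ⟨y, hy, hy0, hyG⟩ := hsurj_map _ (Submodule.sub_mem _ G.2 (hmapV x hx))
    refine ⟨⟨x + y, Submodule.add_mem _ hx hy⟩, Prod.ext (Subtype.ext ?_) (Subtype.ext ?_)⟩
    · change digitBracket p (x + y) = F
      rw [map_add, hxF, hy0, add_zero]
    · change digitMap p (x + y) = G
      rw [map_add, hyG, add_sub_cancel]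
  obtain ⟨hfin, hle⟩ := finrank_Xr1Sub_le (p := p) (s + 1)
  rw [Nat.add_sub_cancel, hsig] at hle
  have hV : Module.finrank (ZMod p) (Vh p b × Vh p (b + 2)) = 2 * (b + 2) := by
    rw [Module.finrank_prod, finrank_Vh, finrank_Vh]
    ring
  have hge := LinearMap.finrank_le_finrank_of_surjective hφ
  rw [hV] at hge
  have heq : Module.finrank (ZMod p) (Xr1Sub p (s + 1)) = 2 * (b + 2) := le_antisymm hle hge
  refine ⟨heq, LinearEquiv.ofBijective φ
    ⟨(LinearMap.injective_iff_surjective_of_finrank_eq_finrank (heq.trans hV.symm)).mpr hφ, hφ⟩,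
    fun g x y hxy => ?_, fun g x y hxy => ?_⟩
  · change digitBracket p y = twAct p 1 g (digitBracket p x)
    rw [hxy, twAct, twAct, pow_zero, one_smul, pow_one, hbrE g x x.2]
  · change digitMap p y = twAct p 0 g (digitMap p x)
    rw [hxy, twAct, twAct, pow_zero, one_smul, one_smul, hmapE g x x.2]
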